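/- arXiv:1203.5665 — 2 statements merged into one kernel-verified Lean document; each statement's English description precedes it below -/
import Mathlib

section
/- Let G be a subgroup of GL_n(ℂ) such that every element of G is unipotent on some finite power (i.e., for each g ∈ G some positive power g^s is unipotent) and suppose G is not virtually solvable. Then G contains a non-abelian free subgroup ℤ * ℤ generated by two elements g₁, g₂ whose images generate a free group; moreover some positive powers g₁^s, g₂^s generate a free subgroup contained in the set of unipotent elements, which is impossible since a group of unipotent matrices is nilpotent. Hence: a subgroup of GL_n(ℂ) all of whose elements have some unipotent positive power and which is closed under taking these powers into a common unipotent subgroup must be virtually solvable. -/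
open Matrix

theorem Int.isJacobsonRing : IsJacobsonRing ℤ := by
  rw [isJacobsonRing_iff_prime_eq]
  intro P hP
  by_cases h : P = ⊥
  · subst h
    rw [eq_bot_iff]
    intro x hx
    rw [Ideal.mem_jacobson_bot] at hx
    have h := hx (2 * x)
    rw [Int.isUnit_iff] at h
    rcases h with h | h
    · have : x * x = 0 := by linarith
      simpa using this
    · nlinarith [mul_self_nonneg x]
  · exact Ideal.jacobson_eq_self_of_isMaximal (H := hP.isMaximal h)

theorem Field.finite_of_finiteType_int (K : Type*) [Field K] [Algebra ℤ K]
    [Algebra.FiniteType ℤ K] :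
    Finite K := by
  obtain rfl : ‹Algebra ℤ K› = Ring.toIntAlgebra K := Subsingleton.elim _ _
  have := Int.isJacobsonRing
  have hfin : Module.Finite ℤ K := finite_of_finite_type_of_isJacobsonRing ℤ K
  obtain ⟨p, hp⟩ := CharP.exists K
  rcases CharP.char_is_prime_or_zero K p with h | rfl
  · have := Fact.mk h
    let := ZMod.algebra K p
    have : Module.Finite (ZMod p) K := Module.Finite.of_restrictScalars_finite ℤ (ZMod p) K
    exact Module.finite_of_finite (ZMod p)
  · have := CharP.charP_to_charZero K
    have h1 : Algebra.IsIntegral ℤ K := inferInstance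
    have := isField_of_isIntegral_of_isField (R := ℤ) (S := K)
      (FaithfulSMul.algebraMap_injective ℤ K) (Field.toIsField K)
    exact absurd this Int.not_isField

theorem Matrix.eq_one_of_pow_eq_one_of_map_eq_one {A ι : Type*} [CommRing A] [IsDomain A]
    [Fintype ι] [DecidableEq ι] {P : Ideal A} [P.IsPrime] {y : Matrix ι ι A} {s : ℕ}
    (hs : (s : A) ∉ P) (hy : y ^ s = 1) (hyP : (Ideal.Quotient.mk P).mapMatrix y = 1) :
    y = 1 := by
  set N : Matrix ι ι A := ∑ i ∈ Finset.range s, y ^ i with hN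
  have h0 : (y - 1) * N = 0 := by rw [mul_geom_sum, hy, sub_self]
  have hNP : (Ideal.Quotient.mk P).mapMatrix N = (s : A ⧸ P) • (1 : Matrix ι ι (A ⧸ P)) := by
    rw [hN, map_sum]
    simp only [map_pow, hyP, one_pow, Finset.sum_const, Finset.card_range,
      Nat.cast_smul_eq_nsmul]
  have hdet : N.det ≠ 0 := by
    intro h
    have h2 := RingHom.map_det (Ideal.Quotient.mk P) N
    rw [hNP, h, det_smul, det_one, mul_one, map_zero] at h2
    have h3 := eq_zero_of_pow_eq_zero h2.symm
    rw [← map_natCast (Ideal.Quotient.mk P), Ideal.Quotient.eq_zero_iff_mem] at h3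
    exact hs h3
  have h1 : N.det • (y - 1) = 0 := by
    have := congrArg (· * N.adjugate) h0
    simpa [Matrix.mul_assoc, mul_adjugate] using this
  exact sub_eq_zero.1 ((smul_eq_zero.1 h1).resolve_left hdet)

theorem Ideal.exists_isMaximal_natCast_notMem (A : Type*) [CommRing A] [IsDomain A] [CharZero A]
    [Algebra.FiniteType ℤ A] {k : ℕ} (hk : k ≠ 0) :
    ∃ P : Ideal A, P.IsMaximal ∧ (k : A) ∉ P := by
  have := Int.isJacobsonRing
  have hA : IsJacobsonRing A := isJacobsonRing_of_finiteType (A := ℤ)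
  by_contra! h
  have h1 : (k : A) ∈ (⊥ : Ideal A).jacobson := by
    rw [Ideal.jacobson, Ideal.mem_sInf]
    exact fun I hI => h I hI.2
  rw [isJacobsonRing_iff_prime_eq.1 hA ⊥ Ideal.isPrime_bot] at h1
  exact hk (by simpa using h1)

theorem Matrix.GeneralLinearGroup.finite_of_isOfFinOrder_of_finiteType {A ι : Type*} [CommRing A]
    [IsDomain A] [CharZero A] [Algebra.FiniteType ℤ A] [Fintype ι] [DecidableEq ι]
    (H : Subgroup (GL ι A)) (hH : ∀ h ∈ H, IsOfFinOrder h) : Finite H := by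
  have hfin : ∀ P : Ideal A, P.IsMaximal → Finite (A ⧸ P) := fun P hP =>
    have : Algebra.FiniteType ℤ (A ⧸ P) :=
      .of_surjective (Ideal.Quotient.mkₐ ℤ P) Ideal.Quotient.mk_surjective
    let := Ideal.Quotient.field P
    Field.finite_of_finiteType_int (A ⧸ P)
  obtain ⟨P, hP, -⟩ := Ideal.exists_isMaximal_natCast_notMem A one_ne_zero
  have := hfin P hP
  let := Ideal.Quotient.field P
  obtain ⟨p, hpc⟩ := CharP.exists (A ⧸ P)
  have hp : p.Prime := (CharP.char_is_prime_or_zero (A ⧸ P) p).resolve_right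
    (CharP.char_ne_zero_of_finite (A ⧸ P) p)
  obtain ⟨Q, hQ, hpQ⟩ := Ideal.exists_isMaximal_natCast_notMem A hp.ne_zero
  have := hfin Q hQ
  let φ : H →* Matrix ι ι (A ⧸ P) × Matrix ι ι (A ⧸ Q) :=
    (((Ideal.Quotient.mk P).mapMatrix.toMonoidHom.prod
      (Ideal.Quotient.mk Q).mapMatrix.toMonoidHom).comp (Units.coeHom _)).comp H.subtype
  refine Finite.of_injective φ ?_
  rw [injective_iff_map_eq_one]
  intro x hx
  have hxP : (Ideal.Quotient.mk P).mapMatrix (x : GL ι A).val = 1 := congrArg Prod.fst hx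
  have hxQ : (Ideal.Quotient.mk Q).mapMatrix (x : GL ι A).val = 1 := congrArg Prod.snd hx
  by_contra hne
  have hord : orderOf (x : GL ι A) ≠ 1 := by
    rw [Ne, orderOf_eq_one_iff]
    exact fun h => hne (Subtype.ext h)
  have hpos : 0 < orderOf (x : GL ι A) := (hH _ x.2).orderOf_pos
  obtain ⟨r, hr, hrd⟩ := Nat.exists_prime_and_dvd hord
  obtain ⟨t, ht⟩ := hrd
  have hz : ((x : GL ι A).val ^ t) ^ r = 1 := by
    rw [← pow_mul, mul_comm, ← ht, ← Units.val_pow_eq_pow_val, pow_orderOf_eq_one, Units.val_one]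
  have hz1 : (x : GL ι A).val ^ t = 1 := by
    by_cases hrP : (r : A) ∈ P
    · have hrp : r = p := by
        rw [← Ideal.Quotient.eq_zero_iff_mem, map_natCast, CharP.cast_eq_zero_iff (A ⧸ P) p] at hrP
        exact ((Nat.prime_dvd_prime_iff_eq hp hr).1 hrP).symm
      subst hrp
      exact Matrix.eq_one_of_pow_eq_one_of_map_eq_one hpQ hz (by rw [map_pow, hxQ, one_pow])
    · exact Matrix.eq_one_of_pow_eq_one_of_map_eq_one hrP hz (by rw [map_pow, hxP, one_pow])
  have hd : orderOf (x : GL ι A) ∣ t := orderOf_dvd_of_pow_eq_one (Units.ext (by simpa using hz1))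
  have ht0 : t ≠ 0 := by rintro rfl; simp [ht] at hpos
  have := Nat.le_of_dvd (Nat.pos_of_ne_zero ht0) hd
  have := hr.two_le
  nlinarith [Nat.pos_of_ne_zero ht0]

/-- **Burnside–Schur theorem**: torsion linear groups in characteristic zero are locally finite. -/
theorem Matrix.GeneralLinearGroup.finite_closure_of_isOfFinOrder {K ι : Type*} [Field K]
    [CharZero K] [Fintype ι] [DecidableEq ι] (H : Subgroup (GL ι K)) (hH : ∀ h ∈ H, IsOfFinOrder h)
    (T : Set (GL ι K)) (hT : T.Finite) (hTH : T ⊆ H) : Finite (Subgroup.closure T) := by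
  let E : Set K := ⋃ t ∈ T, ⋃ i, ⋃ j, {t.val i j, t⁻¹.val i j}
  have hE : E.Finite := hT.biUnion fun t _ => Set.finite_iUnion fun i => Set.finite_iUnion fun j =>
    Set.toFinite _
  let A := Algebra.adjoin ℤ E
  have hA : Algebra.FiniteType ℤ A := by
    rw [← Subalgebra.fg_iff_finiteType]
    exact ⟨hE.toFinset, by simp [A]⟩
  let f : GL ι A →* GL ι K := Matrix.GeneralLinearGroup.map (algebraMap A K)
  have hf : Function.Injective f := by
    intro x y hxy
    ext i j
    exact congrArg (fun z : GL ι K => z.val i j) hxy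
  have hle : Subgroup.closure T ≤ f.range := by
    rw [Subgroup.closure_le]
    intro t ht
    have hsub : ∀ i j, {t.val i j, t⁻¹.val i j} ⊆ (A : Set K) := fun i j x hx =>
      Algebra.subset_adjoin (Set.mem_biUnion ht (Set.mem_iUnion₂.2 ⟨i, j, hx⟩))
    have hmem : ∀ i j, t.val i j ∈ A ∧ t⁻¹.val i j ∈ A := fun i j =>
      Set.pair_subset_iff.1 (hsub i j)
    have hinj : Function.Injective ((algebraMap A K).mapMatrix : Matrix ι ι A →+* Matrix ι ι K) :=
      Matrix.map_injective Subtype.val_injective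
    let x : Matrix ι ι A := Matrix.of fun i j => ⟨t.val i j, (hmem i j).1⟩
    let y : Matrix ι ι A := Matrix.of fun i j => ⟨t⁻¹.val i j, (hmem i j).2⟩
    have hx : (algebraMap A K).mapMatrix x = t.val := rfl
    have hy : (algebraMap A K).mapMatrix y = t⁻¹.val := rfl
    refine ⟨⟨x, y, hinj ?_, hinj ?_⟩, Units.ext hx⟩
    · rw [map_mul, hx, hy, map_one, Units.mul_inv]
    · rw [map_mul, hx, hy, map_one, Units.inv_mul]
  have hfin : Finite ((Subgroup.closure T).comap f) := by
    refine Matrix.GeneralLinearGroup.finite_of_isOfFinOrder_of_finiteType _ fun h hh => ?_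
    rw [← hf.isOfFinOrder_iff]
    exact hH _ ((Subgroup.closure_le H).2 hTH hh)
  rw [← Subgroup.map_comap_eq_self hle]
  exact (Set.Finite.image f (Set.finite_coe_iff.1 hfin)).to_subtype

open scoped ComplexOrder in
theorem Matrix.GeneralLinearGroup.exists_conj_mem_unitaryGroup {ι : Type*} [Fintype ι]
    [DecidableEq ι] (H : Subgroup (GL ι ℂ))
    (hH : ∀ T : Set (GL ι ℂ), T.Finite → T ⊆ H → Finite (Subgroup.closure T)) :
    ∃ B : GL ι ℂ, ∀ h ∈ H, (B * h * B⁻¹).val ∈ unitaryGroup ι ℂ := by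
  let W (T : Set (GL ι ℂ)) : Submodule ℂ (Matrix ι ι ℂ) :=
    { carrier := {P | ∀ g ∈ T, g.valᴴ * P * g.val = P}
      add_mem' := fun {P Q} hP hQ g hg => by rw [mul_add, add_mul, hP g hg, hQ g hg]
      zero_mem' := fun g _ => by simp
      smul_mem' := fun c P hP g hg => by rw [mul_smul_comm, smul_mul_assoc, hP g hg] }
  have hWmem : ∀ T P, P ∈ W T ↔ ∀ g ∈ T, g.valᴴ * P * g.val = P := fun _ _ => Iff.rfl
  let d (T : {T : Set (GL ι ℂ) // T.Finite ∧ T ⊆ H}) : ℕ := Module.finrank ℂ (W T.1)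
  have : Nonempty {T : Set (GL ι ℂ) // T.Finite ∧ T ⊆ H} := ⟨∅, by simp⟩
  let T := Function.argmin d
  have hmin : ∀ T', d T ≤ d T' := fun T' => Function.argmin_le d T'
  have hF := hH T.1 T.2.1 T.2.2
  have := Fintype.ofFinite (Subgroup.closure T.1)
  let P : Matrix ι ι ℂ := ∑ g : Subgroup.closure T.1, g.1.valᴴ * g.1.val
  have hP : P.PosDef := posDef_sum Finset.univ_nonempty fun g _ =>
    PosDef.conjTranspose_mul_self _ (mulVec_injective_of_isUnit g.1.isUnit)
  have hPT : P ∈ W T.1 := by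
    intro g hg
    have hgc : g ∈ Subgroup.closure T.1 := Subgroup.subset_closure hg
    rw [Finset.mul_sum, Finset.sum_mul]
    refine Fintype.sum_equiv (Equiv.mulRight ⟨g, hgc⟩) _ _ fun x => ?_
    simp [Matrix.mul_assoc]
  have hPH : ∀ h ∈ H, h.valᴴ * P * h.val = P := by
    intro h hh
    let T' : {T : Set (GL ι ℂ) // T.Finite ∧ T ⊆ H} :=
      ⟨insert h T.1, T.2.1.insert h, Set.insert_subset hh T.2.2⟩
    have hle : W T'.1 ≤ W T.1 := fun Q hQ g hg => hQ g (Set.mem_insert_of_mem _ hg)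
    have heq : W T'.1 = W T.1 := Submodule.eq_of_le_of_finrank_le hle (hmin T')
    rw [← heq] at hPT
    exact hPT h (Set.mem_insert _ _)
  obtain ⟨B, hB⟩ : ∃ B : Matrix ι ι ℂ, P = star B * B := by
    open scoped MatrixOrder Matrix.Norms.L2Operator in
    exact CStarAlgebra.nonneg_iff_eq_star_mul_self.1 hP.posSemidef.nonneg
  have hBu : IsUnit B := by
    have := hP.isUnit
    rw [hB, isUnit_iff_isUnit_det, det_mul] at this
    exact (isUnit_iff_isUnit_det _).2 (isUnit_of_mul_isUnit_right this)
  obtain ⟨B, rfl⟩ := hBu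
  refine ⟨B, fun h hh => ?_⟩
  rw [mem_unitaryGroup_iff']
  have h1 := hPH h hh
  rw [hB] at h1
  have h2 : star (B⁻¹).val * star B.val = 1 := by
    rw [← star_mul, ← Units.val_mul, mul_inv_cancel, Units.val_one, star_one]
  calc star (B * h * B⁻¹).val * (B * h * B⁻¹).val
      = star (B⁻¹).val * (h.valᴴ * (star B.val * B.val) * h.val) * (B⁻¹).val := by
        simp only [Units.val_mul, star_mul, ← star_eq_conjTranspose, mul_assoc]
    _ = (star (B⁻¹).val * star B.val) * (B.val * (B⁻¹).val) := by rw [h1]; simp only [mul_assoc]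
    _ = 1 := by rw [h2, ← Units.val_mul, mul_inv_cancel, Units.val_one, one_mul]

section Jordan

open scoped commutatorElement

variable {H A : Type*} [Group H] [NormedRing A] {f : H →* A}

theorem MonoidHom.norm_map_mul_sub_one_le (hf : ∀ h, ‖f h‖ ≤ 1) (g h : H) :
    ‖f (g * h) - 1‖ ≤ ‖f g - 1‖ + ‖f h - 1‖ := by
  calc ‖f (g * h) - 1‖ = ‖f g * (f h - 1) + (f g - 1)‖ := by rw [map_mul]; congr 1; noncomm_ring
    _ ≤ ‖f g‖ * ‖f h - 1‖ + ‖f g - 1‖ := (norm_add_le _ _).trans (by gcongr; exact norm_mul_le _ _)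
    _ ≤ 1 * ‖f h - 1‖ + ‖f g - 1‖ := by gcongr; exact hf g
    _ = _ := by ring

theorem MonoidHom.norm_map_inv_sub_one_le (hf : ∀ h, ‖f h‖ ≤ 1) (g : H) :
    ‖f g⁻¹ - 1‖ ≤ ‖f g - 1‖ := by
  calc ‖f g⁻¹ - 1‖ = ‖f g⁻¹ * (1 - f g)‖ := by rw [mul_sub, ← map_mul]; simp
    _ ≤ ‖f g⁻¹‖ * ‖1 - f g‖ := norm_mul_le _ _
    _ ≤ 1 * ‖1 - f g‖ := by gcongr; exact hf _
    _ = _ := by rw [one_mul, norm_sub_rev]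

theorem MonoidHom.norm_map_conj_sub_one_le (hf : ∀ h, ‖f h‖ ≤ 1) (g h : H) :
    ‖f (g * h * g⁻¹) - 1‖ ≤ ‖f h - 1‖ := by
  have h1 : f (g * h * g⁻¹) - 1 = f g * (f h - 1) * f g⁻¹ := by
    rw [mul_sub, sub_mul, mul_one, ← map_mul, ← map_mul, ← map_mul, mul_inv_cancel, map_one]
  calc ‖f (g * h * g⁻¹) - 1‖ ≤ ‖f g‖ * ‖f h - 1‖ * ‖f g⁻¹‖ := by
        rw [h1]; exact norm_mul₃_le
    _ ≤ 1 * ‖f h - 1‖ * 1 := by gcongr <;> exact hf _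
    _ = _ := by ring

theorem MonoidHom.norm_map_commutator_sub_one_le (hf : ∀ h, ‖f h‖ ≤ 1) (a b : H) :
    ‖f ⁅a, b⁆ - 1‖ ≤ 2 * ‖f a - 1‖ * ‖f b - 1‖ := by
  have h1 : f ⁅a, b⁆ - 1 =
      ((f a - 1) * (f b - 1) - (f b - 1) * (f a - 1)) * f (a⁻¹ * b⁻¹) := by
    have h2 : (f a - 1) * (f b - 1) - (f b - 1) * (f a - 1) = f (a * b) - f (b * a) := by
      rw [map_mul, map_mul]; noncomm_ring
    rw [h2, sub_mul, ← map_mul, ← map_mul, commutatorElement_def]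
    simp [mul_assoc]
  calc ‖f ⁅a, b⁆ - 1‖
      ≤ ‖(f a - 1) * (f b - 1) - (f b - 1) * (f a - 1)‖ * ‖f (a⁻¹ * b⁻¹)‖ := by
        rw [h1]; exact norm_mul_le _ _
    _ ≤ (‖f a - 1‖ * ‖f b - 1‖ + ‖f b - 1‖ * ‖f a - 1‖) * 1 := by
        gcongr
        · exact (norm_sub_le _ _).trans (add_le_add (norm_mul_le _ _) (norm_mul_le _ _))
        · exact hf _
    _ = _ := by ring

theorem eq_one_of_pow_eq_one_of_norm_pow_sub_one_le [NormedAlgebra ℝ A] [CompleteSpace A]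
    {x : A} {s : ℕ} (hs : 0 < s) (hx : x ^ s = 1) {r : ℝ} (hr : r < 1)
    (h : ∀ k : ℕ, ‖x ^ k - 1‖ ≤ r) : x = 1 := by
  have hs' : (0 : ℝ) < s := by exact_mod_cast hs
  set E : A := (s : ℝ)⁻¹ • ∑ k ∈ Finset.range s, x ^ k with hE
  have h0 : (x - 1) * E = 0 := by rw [hE, mul_smul_comm, mul_geom_sum, hx, sub_self, smul_zero]
  have h1 : 1 - E = (s : ℝ)⁻¹ • ∑ k ∈ Finset.range s, (1 - x ^ k) := by
    rw [Finset.sum_sub_distrib, smul_sub, ← hE]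
    congr 1
    rw [Finset.sum_const, Finset.card_range, ← Nat.cast_smul_eq_nsmul ℝ, smul_smul,
      inv_mul_cancel₀ hs'.ne', one_smul]
  have h2 : ‖1 - E‖ < 1 := by
    refine lt_of_le_of_lt ?_ hr
    calc ‖1 - E‖ ≤ (s : ℝ)⁻¹ * ∑ k ∈ Finset.range s, r := by
          rw [h1, norm_smul, Real.norm_of_nonneg (by positivity)]
          gcongr
          exact norm_sum_le_of_le _ fun k _ => by rw [norm_sub_rev]; exact h k
      _ = r := by
          rw [Finset.sum_const, Finset.card_range, nsmul_eq_mul, ← mul_assoc,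
            inv_mul_cancel₀ hs'.ne', one_mul]
  have h3 : IsUnit E := by simpa using isUnit_one_sub_of_norm_lt_one h2
  exact sub_eq_zero.1 (h3.mul_left_eq_zero.1 h0)

theorem MonoidHom.commute_of_commute_commutator [NormedAlgebra ℝ A] [CompleteSpace A]
    (hf : ∀ h, ‖f h‖ ≤ 1) (hinj : Function.Injective f) {a b : H} (hb : ‖f b - 1‖ < 1 / 2)
    (hab : Commute a ⁅a, b⁆) (hfin : IsOfFinOrder ⁅a, b⁆) : Commute a b := by
  rw [← commutatorElement_eq_one_iff_commute]
  have hconj : ∀ k : ℕ, ⁅a, b⁆ ^ k = (a ^ k * b * (a ^ k)⁻¹) * b⁻¹ := by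
    intro k
    induction k with
    | zero => simp
    | succ k ih =>
      have h1 : a * ⁅a, b⁆ ^ k * a⁻¹ = ⁅a, b⁆ ^ k := by
        rw [(hab.pow_right k).eq, mul_inv_cancel_right]
      calc ⁅a, b⁆ ^ (k + 1) = (a * ⁅a, b⁆ ^ k * a⁻¹) * ⁅a, b⁆ := by rw [pow_succ, h1]
        _ = _ := by rw [ih, commutatorElement_def, pow_succ']; group
  apply hinj
  rw [map_one]
  refine eq_one_of_pow_eq_one_of_norm_pow_sub_one_le (r := ‖f b - 1‖ + ‖f b - 1‖) hfin.orderOf_pos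
    (by rw [← map_pow, pow_orderOf_eq_one, map_one]) (by linarith) fun k => ?_
  rw [← map_pow, hconj]
  exact (norm_map_mul_sub_one_le hf _ _).trans
    (add_le_add (norm_map_conj_sub_one_le hf _ _) (norm_map_inv_sub_one_le hf _))

theorem MonoidHom.commute_of_norm_sub_one_le [NormedAlgebra ℝ A] [CompleteSpace A]
    (hf : ∀ h, ‖f h‖ ≤ 1) (hinj : Function.Injective f)
    {a b : H} (hfin : Finite (Subgroup.closure {a, b})) (ha : ‖f a - 1‖ ≤ 1 / 4)
    (hb : ‖f b - 1‖ ≤ 1 / 4) : Commute a b := by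
  set K := Subgroup.closure {a, b} with hK
  have haK : a ∈ K := Subgroup.subset_closure (by simp)
  have hbK : b ∈ K := Subgroup.subset_closure (by simp)
  have hcK : ∀ x ∈ K, ⁅a, x⁆ ∈ K := fun x hx =>
    mul_mem (mul_mem (mul_mem haK hx) (inv_mem haK)) (inv_mem hx)
  have hsmall : ∀ x, ‖f ⁅a, x⁆ - 1‖ ≤ 1 / 2 * ‖f x - 1‖ := fun x =>
    (norm_map_commutator_sub_one_le hf a x).trans (by nlinarith [norm_nonneg (f x - 1)])
  have hiter : ∀ k : ℕ, ((fun x => ⁅a, x⁆)^[k] b) ∈ K ∧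
      ‖f ((fun x => ⁅a, x⁆)^[k] b) - 1‖ ≤ (1 / 2) ^ k * (1 / 4) := by
    intro k
    induction k with
    | zero => simpa using ⟨hbK, by simpa using hb⟩
    | succ k ih =>
      rw [Function.iterate_succ_apply']
      exact ⟨hcK _ ih.1, (hsmall _).trans (by rw [pow_succ]; linarith [ih.2])⟩
  obtain ⟨δ, hδ, hδK⟩ : ∃ δ > 0, ∀ x ∈ K, ‖f x - 1‖ < δ → x = 1 := by
    have hKf : (K : Set H).Finite := Set.finite_coe_iff.1 hfin
    have hev : ∀ᶠ δ : ℝ in nhdsWithin 0 (Set.Ioi 0), ∀ x ∈ (K : Set H), ‖f x - 1‖ < δ → x = 1 := by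
      rw [Filter.eventually_all_finite hKf]
      intro x _
      by_cases hx : x = 1
      · simp [hx]
      · have hpos : 0 < ‖f x - 1‖ := by
          rw [norm_pos_iff, sub_ne_zero]
          exact fun h => hx (hinj (h.trans f.map_one.symm))
        filter_upwards [mem_nhdsWithin_of_mem_nhds (Iio_mem_nhds hpos)] with δ hδ h
        exact absurd h (not_lt.2 (le_of_lt hδ))
    obtain ⟨δ, h1, h2⟩ := (hev.and self_mem_nhdsWithin).exists
    exact ⟨δ, h2, h1⟩
  obtain ⟨k, hk⟩ := exists_pow_lt_of_lt_one hδ (by norm_num : (1 / 2 : ℝ) < 1)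
  have hk1 : (fun x => ⁅a, x⁆)^[k] b = 1 := hδK _ (hiter k).1
    ((hiter k).2.trans_lt (by nlinarith [pow_pos (by norm_num : (0 : ℝ) < 1 / 2) k]))
  have hdesc : ∀ k : ℕ, ∀ x ∈ K, ‖f x - 1‖ ≤ 1 / 4 → (fun x => ⁅a, x⁆)^[k] x = 1 →
      Commute a x := by
    intro k
    induction k with
    | zero => rintro x - - rfl; exact Commute.one_right a
    | succ k ih =>
      intro x hx hxs hk
      rw [Function.iterate_succ_apply] at hk
      have h1 := ih _ (hcK x hx) ((hsmall x).trans (by linarith)) hk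
      refine commute_of_commute_commutator hf hinj (by linarith) h1 ?_
      exact K.subtype.isOfFinOrder (isOfFinOrder_of_finite (⟨_, hcK x hx⟩ : K))
  exact hdesc k b hbK hb hk1

/-- **Jordan's theorem** for locally finite groups acting by contractions. -/
theorem MonoidHom.exists_finiteIndex_commute [NormedAlgebra ℝ A] [FiniteDimensional ℝ A]
    (hf : ∀ h, ‖f h‖ ≤ 1) (hinj : Function.Injective f)
    (hfin : ∀ a b : H, Finite (Subgroup.closure {a, b})) :
    ∃ S : Subgroup H, S.FiniteIndex ∧ ∀ a ∈ S, ∀ b ∈ S, a * b = b * a := by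
  have := FiniteDimensional.complete ℝ A
  have := FiniteDimensional.proper ℝ A
  let N : Set H := {h | ‖f h - 1‖ ≤ 1 / 4}
  refine ⟨Subgroup.closure N, ?_, ?_⟩
  · obtain ⟨t, htf, ht⟩ := Metric.totallyBounded_iff.1
      (isCompact_closedBall (0 : A) 1).totallyBounded (1 / 8) (by norm_num)
    have hc : ∀ h : H, ∃ y ∈ t, dist (f h) y < 1 / 8 := fun h => by
      simpa using ht (show f h ∈ Metric.closedBall (0 : A) 1 by simpa using hf h)
    choose c hct hc using hc
    have hQ : Finite (H ⧸ Subgroup.closure N) := by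
      have := htf.to_subtype
      refine Finite.of_injective
        (fun q : H ⧸ Subgroup.closure N => (⟨c q.out, hct q.out⟩ : t)) fun p q hpq => ?_
      have hpq' : c p.out = c q.out := congrArg Subtype.val hpq
      rw [← p.out_eq', ← q.out_eq', QuotientGroup.eq]
      refine Subgroup.subset_closure ?_
      have h1 : ‖f q.out - f p.out‖ ≤ 1 / 4 := by
        rw [← dist_eq_norm]
        have h2 := hc p.out
        rw [hpq'] at h2
        linarith [dist_triangle_right (f q.out) (f p.out) (c q.out), hc q.out]
      calc ‖f (p.out⁻¹ * q.out) - 1‖ = ‖f p.out⁻¹ * (f q.out - f p.out)‖ := by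
            rw [mul_sub, ← map_mul, ← map_mul, inv_mul_cancel, map_one]
        _ ≤ ‖f p.out⁻¹‖ * ‖f q.out - f p.out‖ := norm_mul_le _ _
        _ ≤ 1 * (1 / 4) := by gcongr; exact hf _
        _ = 1 / 4 := one_mul _
    exact Subgroup.finiteIndex_of_finite_quotient
  · have hcomm : ∀ a ∈ N, ∀ b ∈ N, a * b = b * a := fun a ha b hb =>
      commute_of_norm_sub_one_le hf hinj (hfin a b) ha hb
    intro a ha b hb
    have := Subgroup.isMulCommutative_closure hcomm
    exact setLike_mul_comm ha hb

end Jordan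

theorem Matrix.GeneralLinearGroup.exists_finiteIndex_commute_of_isOfFinOrder {ι : Type*} [Fintype ι]
    [DecidableEq ι] (H : Subgroup (GL ι ℂ)) (hH : ∀ h ∈ H, IsOfFinOrder h) :
    ∃ S : Subgroup H, S.FiniteIndex ∧ ∀ a ∈ S, ∀ b ∈ S, a * b = b * a := by
  open scoped Matrix.Norms.L2Operator in
  have hlf := finite_closure_of_isOfFinOrder H hH
  obtain ⟨B, hB⟩ := exists_conj_mem_unitaryGroup H hlf
  let f : H →* Matrix ι ι ℂ :=
    (Units.coeHom _).comp ((MulAut.conj B : GL ι ℂ →* GL ι ℂ).comp H.subtype)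
  have hf : ∀ h, ‖f h‖ ≤ 1 := by
    intro h
    rcases subsingleton_or_nontrivial (Matrix ι ι ℂ) with _ | _
    · rw [Subsingleton.elim (f h) 0, norm_zero]
      exact zero_le_one
    · exact (CStarRing.norm_of_mem_unitary (hB h h.2)).le
  have hinj : Function.Injective f :=
    Units.val_injective.comp ((MulAut.conj B).injective.comp H.subtype_injective)
  have : FiniteDimensional ℝ (Matrix ι ι ℂ) := .complexToReal _
  refine f.exists_finiteIndex_commute hf hinj fun a b => ?_
  have h := hlf {a.1, b.1} (Set.toFinite _) (by
    rintro _ (rfl | rfl) <;> exact SetLike.coe_mem _)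
  have hmap : (Subgroup.closure {a, b}).map H.subtype = Subgroup.closure {a.1, b.1} := by
    rw [MonoidHom.map_closure, Set.image_pair]
    rfl
  rw [← hmap] at h
  exact Finite.of_equiv _
    ((Subgroup.closure {a, b}).equivMapOfInjective _ H.subtype_injective).symm.toEquiv

section Kolchin

variable {K V : Type*} [Field K] [AddCommGroup V] [Module K V] [FiniteDimensional K V]

theorem LinearMap.trace_eq_finrank_of_isNilpotent_sub_one {f : Module.End K V}
    (hf : IsNilpotent (f - 1)) : LinearMap.trace K V f = Module.finrank K V := by
  have h := (LinearMap.isNilpotent_trace_of_isNilpotent hf).eq_zero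
  rwa [map_sub, LinearMap.trace_one, sub_eq_zero] at h

theorem LinearMap.eq_zero_of_forall_trace_mul_eq_zero {f : Module.End K V}
    (hf : ∀ g : Module.End K V, LinearMap.trace K V (f * g) = 0) : f = 0 := by
  ext x
  rw [LinearMap.zero_apply, ← Module.forall_dual_apply_eq_zero_iff K]
  intro φ
  have h : f * φ.smulRight x = φ.smulRight (f x) := by ext; simp
  rw [← LinearMap.trace_smulRight φ (f x), ← h, hf]

/-- **Burnside's theorem** on irreducible algebras of endomorphisms. -/
theorem IsSimpleModule.exists_smul_eq_of_isAlgClosed [IsAlgClosed K] {A : Type*} [Ring A]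
    [Algebra K A] [Module A V] [IsScalarTower K A V] [IsSimpleModule A V] (f : Module.End K V) :
    ∃ a : A, ∀ v, f v = a • v := by
  let F : Module.End (Module.End A V) V :=
    { toFun := f
      map_add' := f.map_add
      map_smul' := fun φ v => by
        obtain ⟨c, rfl⟩ :=
          (IsSimpleModule.algebraMap_end_bijective_of_isAlgClosed (A := A) (V := V) K).2 φ
        simp }
  let b := Module.finBasis K V
  classical
  obtain ⟨a, ha⟩ := jacobson_density F (Finset.univ.image b)
  refine ⟨a, fun v => ?_⟩
  have h : f = Algebra.lsmul K K V a := b.ext fun i => ha (b i) (by simp)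
  rw [h, Algebra.lsmul_coe]

theorem IsSimpleModule.smul_eq_of_isNilpotent_sub_one [IsAlgClosed K] {A : Type*} [Ring A]
    [Algebra K A] [Module A V] [IsScalarTower K A V] [IsSimpleModule A V] (M : Submonoid A)
    (hspan : Submodule.span K (M : Set A) = ⊤) (hM : ∀ g ∈ M, IsNilpotent (g - 1)) {g : A}
    (hg : g ∈ M) (v : V) : g • v = v := by
  let L : A →ₐ[K] Module.End K V := Algebra.lsmul K K V
  have htr : ∀ g ∈ M, LinearMap.trace K V (L g) = Module.finrank K V := fun g hg =>
    LinearMap.trace_eq_finrank_of_isNilpotent_sub_one (by simpa using (hM g hg).map L)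
  have hzero : ∀ a : A, LinearMap.trace K V ((L g - 1) * L a) = 0 := by
    intro a
    have ha : a ∈ Submodule.span K (M : Set A) := hspan ▸ Submodule.mem_top
    induction ha using Submodule.span_induction with
    | mem x hx =>
      rw [sub_mul, one_mul, map_sub, ← map_mul L, htr _ (mul_mem hg hx), htr x hx, sub_self]
    | zero => rw [map_zero, mul_zero, map_zero]
    | add x y _ _ ihx ihy => rw [map_add, mul_add, map_add, ihx, ihy, add_zero]
    | smul c x _ ih => rw [map_smul, mul_smul_comm, map_smul, ih, smul_zero]
  have hone : L g - 1 = 0 := LinearMap.eq_zero_of_forall_trace_mul_eq_zero fun f => by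
    obtain ⟨a, ha⟩ := IsSimpleModule.exists_smul_eq_of_isAlgClosed (A := A) f
    rw [show f = L a from LinearMap.ext ha, hzero]
  exact LinearMap.congr_fun (sub_eq_zero.1 hone) v

/-- **Kolchin's theorem**: a monoid of unipotent endomorphisms has a nonzero fixed vector. -/
theorem Submonoid.exists_ne_zero_forall_apply_eq [IsAlgClosed K] [Nontrivial V]
    (M : Submonoid (Module.End K V)) (hM : ∀ g ∈ M, IsNilpotent (g - 1)) :
    ∃ v : V, v ≠ 0 ∧ ∀ g ∈ M, g v = v := by
  let A := Algebra.adjoin K (M : Set (Module.End K V))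
  have : IsArtinian A V := isArtinian_of_tower K inferInstance
  obtain ⟨W, hW⟩ := IsAtomic.exists_atom (Submodule A V)
  rw [← isSimpleModule_iff_isAtom] at hW
  have : Nontrivial W := IsSimpleModule.nontrivial A W
  have : FiniteDimensional K W :=
    inferInstanceAs (FiniteDimensional K (W.restrictScalars K))
  have hMA : ∀ g ∈ M, g ∈ A := fun g hg => Algebra.subset_adjoin hg
  have hspan : Submodule.span K (M.comap A.val : Set A) = ⊤ := by
    refine Submodule.map_injective_of_injective (f := A.val.toLinearMap)
      Subtype.val_injective ?_
    have h := Algebra.adjoin_eq_span K (M : Set (Module.End K V))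
    rw [Submonoid.closure_eq] at h
    rw [Submodule.map_span, Submodule.map_top]
    have himage : A.val.toLinearMap '' (M.comap A.val : Set A) = M := by
      ext g
      exact ⟨by rintro ⟨x, hx, rfl⟩; exact hx, fun hg => ⟨⟨g, hMA g hg⟩, hg, rfl⟩⟩
    rw [himage, ← h]
    ext g
    exact ⟨fun hg => ⟨⟨g, hg⟩, rfl⟩, by rintro ⟨x, rfl⟩; exact x.2⟩
  obtain ⟨w, hw⟩ := exists_ne (0 : W)
  refine ⟨w, fun h => hw (Subtype.ext h), fun g hg => ?_⟩
  exact congrArg Subtype.val (IsSimpleModule.smul_eq_of_isNilpotent_sub_one (K := K)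
    (M.comap A.val) hspan (fun x hx => (IsNilpotent.map_iff (f := A.val)
      Subtype.val_injective).1 (by simpa using hM x hx)) (g := ⟨g, hMA g hg⟩) hg w)

end Kolchin

section VirtuallySolvable

open scoped commutatorElement

variable {G V : Type*} [Group G] [AddCommGroup V]

theorem MonoidHom.map_commutatorElement_eq_one {M : Type*} [Monoid M] (f : G →* M) {a b : G}
    (h : f a * f b = f b * f a) : f ⁅a, b⁆ = 1 := by
  rw [← map_mul, ← map_mul] at h
  rw [commutatorElement_def, mul_assoc, ← _root_.mul_inv_rev, map_mul, h, ← map_mul, mul_inv_cancel,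
    map_one]

theorem Subgroup.coe_mem_derivedSeries_of_le {S T : Subgroup G} (h : S ≤ T) {k : ℕ} {g : S}
    (hg : g ∈ derivedSeries S k) : Subgroup.inclusion h g ∈ derivedSeries T k :=
  map_derivedSeries_le_derivedSeries (Subgroup.inclusion h) k (Subgroup.mem_map_of_mem _ hg)

theorem Module.End.mul_eq_mul_of_sub_one_mem {R : Type*} [Ring R] [Module R V] {W : Submodule R V}
    {f g : Module.End R V} (hf : ∀ w ∈ W, f w = w) (hg : ∀ w ∈ W, g w = w)
    (hf' : ∀ v, f v - v ∈ W) (hg' : ∀ v, g v - v ∈ W) : f * g = g * f := by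
  ext v
  have h1 := hf _ (hg' v)
  have h2 := hg _ (hf' v)
  rw [map_sub] at h1 h2
  rw [Module.End.mul_apply, Module.End.mul_apply, sub_eq_iff_eq_add.1 h1, sub_eq_iff_eq_add.1 h2]
  abel

variable [Module ℂ V] [FiniteDimensional ℂ V]

theorem Representation.exists_finiteIndex_commute_of_pow_eq_one (ρ : Representation ℂ G V)
    (hρ : ∀ g, ∃ s : ℕ, 0 < s ∧ ρ (g ^ s) = 1) :
    ∃ S : Subgroup G, S.FiniteIndex ∧ ∀ a ∈ S, ∀ b ∈ S, ρ a * ρ b = ρ b * ρ a := by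
  let e := algEquivMatrix (Module.finBasis ℂ V)
  let φ : G →* GL (Fin (Module.finrank ℂ V)) ℂ :=
    (Units.map (e : _ →* _)).comp ρ.toHomUnits
  have hφ : ∀ g, (φ g).val = e (ρ g) := fun g => rfl
  have htor : ∀ h ∈ φ.range, IsOfFinOrder h := by
    rintro _ ⟨g, rfl⟩
    obtain ⟨s, hs, h⟩ := hρ g
    exact isOfFinOrder_iff_pow_eq_one.2 ⟨s, hs, by
      rw [← map_pow]; exact Units.ext (by rw [hφ, h, map_one, Units.val_one])⟩
  obtain ⟨S, hS, hcomm⟩ :=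
    Matrix.GeneralLinearGroup.exists_finiteIndex_commute_of_isOfFinOrder φ.range htor
  refine ⟨S.comap φ.rangeRestrict, ⟨?_⟩, fun a ha b hb => ?_⟩
  · rw [Subgroup.index_comap_of_surjective S φ.rangeRestrict_surjective]
    exact hS.index_ne_zero
  · apply e.injective
    rw [map_mul, map_mul]
    exact congrArg (fun x : φ.range => x.1.val) (hcomm _ ha _ hb)

theorem Representation.exists_finiteIndex_derivedSeries_map_eq_one (N : Subgroup G) [N.Normal]
    (hpow : ∀ g : G, ∃ s : ℕ, 0 < s ∧ g ^ s ∈ N) (ρ : Representation ℂ G V)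
    (hN : ∀ g ∈ N, IsNilpotent (ρ g - 1)) :
    ∃ S : Subgroup G, S.FiniteIndex ∧ ∃ k, ∀ g ∈ derivedSeries S k, ρ g = 1 := by
  induction hd : Module.finrank ℂ V using Nat.strong_induction_on generalizing V with
  | _ d ih =>
  rcases subsingleton_or_nontrivial V with hV | hV
  · exact ⟨⊤, inferInstance, 0, fun g _ => Subsingleton.elim _ _⟩
  let W := Representation.invariants (ρ.comp N.subtype)
  have hWmem : ∀ w, w ∈ W ↔ ∀ g ∈ N, ρ g w = w := fun w => by
    simp [W, Representation.mem_invariants]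
  have hW : W ≠ ⊥ := by
    obtain ⟨v, hv, hfix⟩ := Submonoid.exists_ne_zero_forall_apply_eq
      (N.toSubmonoid.map ρ) (by rintro _ ⟨g, hg, rfl⟩; exact hN g hg)
    exact (Submodule.ne_bot_iff W).2
      ⟨v, (hWmem v).2 fun g hg => hfix _ ⟨g, hg, rfl⟩, hv⟩
  have hWG : ∀ g, W ≤ W.comap (ρ g) := fun g w hw => (ρ.toInvariants N g ⟨w, hw⟩).2
  obtain ⟨S₁, hS₁, hcomm⟩ := (ρ.toInvariants N).exists_finiteIndex_commute_of_pow_eq_one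
    fun g => by
      obtain ⟨s, hs, h⟩ := hpow g
      exact ⟨s, hs, LinearMap.ext fun w => Subtype.ext ((hWmem w).1 w.2 _ h)⟩
  have hquot : ∀ g v, ρ.quotient W hWG g (W.mkQ v) = W.mkQ (ρ g v) := fun _ _ => rfl
  have hlt : Module.finrank ℂ (V ⧸ W) < d := by
    have h1 := W.finrank_quotient_add_finrank
    have h2 := Submodule.one_le_finrank_iff.2 hW
    omega
  obtain ⟨S₂, hS₂, k, hk⟩ := ih _ hlt (ρ.quotient W hWG) (fun g hg => by
    obtain ⟨s, hs⟩ := hN g hg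
    refine ⟨s, ?_⟩
    have h : ∀ (s : ℕ) (v : V), ((ρ.quotient W hWG g - 1 : Module.End ℂ (V ⧸ W)) ^ s) (W.mkQ v) =
        W.mkQ (((ρ g - 1 : Module.End ℂ V) ^ s) v) := by
      intro s
      induction s with
      | zero => intro v; rfl
      | succ s ih => intro v; rw [pow_succ, pow_succ, Module.End.mul_apply, Module.End.mul_apply,
          ← ih, LinearMap.sub_apply, hquot]; rfl
    refine LinearMap.ext fun x => ?_
    obtain ⟨v, rfl⟩ := W.mkQ_surjective x
    rw [h, hs]
    simp) rfl
  refine ⟨S₁ ⊓ S₂, inferInstance, max 1 k + 1, ?_⟩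
  have h1 : ∀ g ∈ derivedSeries (S₁ ⊓ S₂ : Subgroup G) (max 1 k), ∀ w ∈ W, ρ g w = w := by
    intro g hg w hw
    have hle : derivedSeries S₁ 1 ≤ ((ρ.toInvariants N).comp S₁.subtype).ker := by
      rw [derivedSeries_one, commutator_def, Subgroup.commutator_le]
      exact fun a _ b _ => MonoidHom.map_commutatorElement_eq_one _ (hcomm a a.2 b b.2)
    have h2 := hle (Subgroup.coe_mem_derivedSeries_of_le inf_le_left
      (derivedSeries_antitone _ (le_max_left 1 k) hg))
    exact congrArg Subtype.val (LinearMap.congr_fun h2 ⟨w, hw⟩)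
  have h2 : ∀ g ∈ derivedSeries (S₁ ⊓ S₂ : Subgroup G) (max 1 k), ∀ v, ρ g v - v ∈ W := by
    intro g hg v
    have h3 := hk _ (Subgroup.coe_mem_derivedSeries_of_le inf_le_right
      (derivedSeries_antitone _ (le_max_right 1 k) hg))
    have h4 := LinearMap.congr_fun h3 (W.mkQ v)
    exact (Submodule.Quotient.eq W).1 h4
  have hle : derivedSeries (S₁ ⊓ S₂ : Subgroup G) (max 1 k + 1) ≤
      (ρ.comp (S₁ ⊓ S₂ : Subgroup G).subtype).ker := by
    rw [derivedSeries_succ, Subgroup.commutator_le]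
    exact fun a ha b hb => MonoidHom.map_commutatorElement_eq_one _
      (Module.End.mul_eq_mul_of_sub_one_mem (h1 a ha) (h1 b hb) (h2 a ha) (h2 b hb))
  exact fun g hg => hle hg

end VirtuallySolvable

/-- Clean statement from the proof of Theorem 2.2(1): if `G ≤ GL_n(ℂ)` is such
that the set `U` of unipotent elements of `G` is a subgroup and every element
of `G` has some positive power lying in `U` (i.e. unipotent), then `G` is
virtually solvable. -/
theorem stmt7 (n : ℕ) (G : Subgroup (GL (Fin n) ℂ))
    (U : Subgroup (GL (Fin n) ℂ))
    (hU : (U : Set (GL (Fin n) ℂ)) =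
      {g | g ∈ G ∧ IsNilpotent ((g : Matrix (Fin n) (Fin n) ℂ) - 1)})
    (hpow : ∀ g ∈ G, ∃ s : ℕ, 0 < s ∧
      IsNilpotent (((g ^ s : GL (Fin n) ℂ) : Matrix (Fin n) (Fin n) ℂ) - 1)) :
    ∃ S : Subgroup G, S.FiniteIndex ∧ IsSolvable S := by
  have hUmem : ∀ g, g ∈ U ↔ g ∈ G ∧ IsNilpotent (g.val - 1) := fun g => Set.ext_iff.1 hU g
  have hnormal : (U.subgroupOf G).Normal := by
    refine ⟨fun g hg x => ?_⟩
    rw [Subgroup.mem_subgroupOf, hUmem] at hg ⊢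
    refine ⟨SetLike.coe_mem _, ?_⟩
    obtain ⟨k, hk⟩ := hg.2
    have h1 : (x * g * x⁻¹ : G).1.val - 1 = x.1.val * (g.1.val - 1) * (x.1⁻¹).val := by
      rw [mul_sub, sub_mul, mul_one, ← Units.val_mul, ← Units.val_mul, ← Units.val_mul,
        mul_inv_cancel]
      rfl
    exact ⟨k, by rw [h1, Units.conj_pow, hk, mul_zero, zero_mul]⟩
  let ρ : Representation ℂ G (Fin n → ℂ) :=
    ((toLinAlgEquiv' : Matrix (Fin n) (Fin n) ℂ ≃ₐ[ℂ] _) : _ →* _).comp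
      ((Units.coeHom _).comp G.subtype)
  have hρ : ∀ g, ρ g = toLinAlgEquiv' g.1.val := fun _ => rfl
  obtain ⟨S, hS, k, hk⟩ := ρ.exists_finiteIndex_derivedSeries_map_eq_one (U.subgroupOf G)
    (fun g => by
      obtain ⟨s, hs, h⟩ := hpow g g.2
      exact ⟨s, hs, Subgroup.mem_subgroupOf.2 ((hUmem _).2 ⟨pow_mem g.2 s, h⟩)⟩)
    (fun g hg => by
      have h := ((hUmem _).1 (Subgroup.mem_subgroupOf.1 hg)).2.map
        (toLinAlgEquiv' : Matrix (Fin n) (Fin n) ℂ ≃ₐ[ℂ] _)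
      rwa [map_sub, map_one] at h)
  refine ⟨S, hS, ⟨k, (Subgroup.eq_bot_iff_forall _).2 fun g hg => ?_⟩⟩
  have h := hk g hg
  rw [hρ, EmbeddingLike.map_eq_one_iff, Units.val_eq_one] at h
  exact Subtype.ext (Subtype.ext h)
end

section
/- Let G ≤ GL_n(ℂ) be a group such that some normal subgroup U consisting of unipotent elements has finite index in G, and let G act on a lattice L ≅ ℤ^ℓ (G ≤ GL(L)). Then G | L is finitely generated; more precisely, the unipotent part U | L is generated by at most ℓ(ℓ−1)/2 elements, where ℓ = rank L. -/
open Matrix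

section Nilpotent

open Polynomial

/-- A square matrix over a field of characteristic zero all of whose positive powers have trace
zero is nilpotent. -/
theorem Matrix.isNilpotent_of_trace_pow_eq_zero {n K : Type*} [Fintype n] [DecidableEq n]
    [Field K] [CharZero K] (M : Matrix n n K) (h : ∀ k, trace (M ^ (k + 1)) = 0) :
    IsNilpotent M := by
  have htr (p : K[X]) : trace (aeval M (p * X)) = 0 := by
    induction p using Polynomial.induction_on' with
    | add p q hp hq => rw [add_mul, map_add, trace_add, hp, hq, add_zero]
    | monomial k a =>
      rw [← C_mul_X_pow_eq_monomial, mul_assoc, ← pow_succ, map_mul, aeval_C, map_pow, aeval_X,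
        ← Algebra.smul_def, trace_smul, h, smul_zero]
  obtain ⟨q, hq, hXq⟩ := exists_eq_pow_rootMultiplicity_mul_and_not_dvd M.charpoly
    M.charpoly_monic.ne_zero 0
  rw [C_0, sub_zero] at hq hXq
  set a := M.charpoly.rootMultiplicity 0
  have hkill : aeval M (X ^ (a + 1) * q) = 0 := by
    rw [pow_succ', mul_assoc, ← hq, map_mul, aeval_self_charpoly, mul_zero]
  obtain ⟨r, s, hrs⟩ : IsCoprime (X ^ (a + 1)) q :=
    (irreducible_X.coprime_iff_not_dvd.2 hXq).pow_left
  have hidem : IsIdempotentElem (aeval M (r * X ^ (a + 1))) := by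
    rw [IsIdempotentElem, ← map_mul, ← sub_eq_zero, ← map_sub,
      show r * X ^ (a + 1) * (r * X ^ (a + 1)) - r * X ^ (a + 1)
        = -(r * s) * (X ^ (a + 1) * q) by linear_combination (r * X ^ (a + 1)) * hrs,
      map_mul, hkill, mul_zero]
  have hzero : aeval M (r * X ^ (a + 1)) = 0 := by
    have htr' : LinearMap.trace K (n → K) (toLinAlgEquiv' (aeval M (r * X ^ (a + 1)))) = 0 := by
      have := htr (r * X ^ a)
      rw [mul_assoc, ← pow_succ] at this
      rw [← this]
      exact Matrix.trace_toLin'_eq _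
    have := (LinearMap.IsIdempotentElem.trace_eq_zero_iff (hidem.map toLinAlgEquiv')).1 htr'
    exact toLinAlgEquiv'.injective (this.trans (map_zero _).symm)
  refine ⟨a + 1, ?_⟩
  have : (X ^ (a + 1) : K[X]) = X ^ (a + 1) * (r * X ^ (a + 1)) + s * (X ^ (a + 1) * q) := by
    linear_combination -(X ^ (a + 1)) * hrs
  have := congrArg (aeval M) this
  rwa [map_add, map_mul, hzero, map_mul, hkill, mul_zero, mul_zero, add_zero, map_pow,
    aeval_X] at this

/-- An endomorphism of a lattice all of whose positive powers have trace zero is nilpotent. -/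
theorem LinearMap.isNilpotent_of_trace_pow_eq_zero {L : Type*} [AddCommGroup L]
    [Module.Free ℤ L] [Module.Finite ℤ L] (f : Module.End ℤ L)
    (h : ∀ k, LinearMap.trace ℤ L (f ^ (k + 1)) = 0) : IsNilpotent f := by
  classical
  let b := Module.Free.chooseBasis ℤ L
  let Φ := (Int.castRingHom ℚ).mapMatrix.comp (LinearMap.toMatrixAlgEquiv b).toRingEquiv.toRingHom
  have hΦ : Function.Injective Φ :=
    (Matrix.map_injective (Int.castRingHom ℚ).injective_int).comp
      (LinearMap.toMatrixAlgEquiv b).injective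
  refine (IsNilpotent.map_iff hΦ).1 (Matrix.isNilpotent_of_trace_pow_eq_zero _ fun k ↦ ?_)
  rw [← map_pow]
  have := h k
  rw [LinearMap.trace_eq_matrix_trace ℤ b] at this
  have h2 := congrArg (Int.castRingHom ℚ) this
  rw [map_zero, AddMonoidHom.map_trace] at h2
  exact h2

end Nilpotent

namespace Representation

attribute [local instance] LieRing.ofAssociativeRing

variable {G L : Type*} [Group G] [AddCommGroup L]

/-- Kolchin's theorem for lattices: a group of unipotent automorphisms of a nonzero lattice
fixes a nonzero vector. -/
theorem invariants_ne_bot_of_isNilpotent_sub_one [Module.Free ℤ L] [Module.Finite ℤ L]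
    [Nontrivial L] (ρ : Representation ℤ G L) (h : ∀ g, IsNilpotent (ρ g - 1)) :
    ρ.invariants ≠ ⊥ := by
  let N : Submodule ℤ (Module.End ℤ L) := Submodule.span ℤ (Set.range fun g ↦ ρ g - 1)
  have hmul {x y} (hx : x ∈ N) (hy : y ∈ N) : x * y ∈ N := by
    have : x * y ∈ N * N := Submodule.mul_mem_mul hx hy
    rw [Submodule.span_mul_span] at this
    refine Submodule.span_le.2 ?_ this
    rintro _ ⟨_, ⟨g, rfl⟩, _, ⟨k, rfl⟩, rfl⟩
    have : (ρ g - 1) * (ρ k - 1) = (ρ (g * k) - 1) - (ρ g - 1) - (ρ k - 1) := by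
      rw [map_mul]; noncomm_ring
    simp only [this]
    exact N.sub_mem (N.sub_mem (Submodule.subset_span ⟨_, rfl⟩) (Submodule.subset_span ⟨_, rfl⟩))
      (Submodule.subset_span ⟨_, rfl⟩)
  have htr {x} (hx : x ∈ N) : LinearMap.trace ℤ L x = 0 := by
    refine Submodule.span_le (p := LinearMap.ker (LinearMap.trace ℤ L)).2 ?_ hx
    rintro _ ⟨g, rfl⟩
    exact (LinearMap.isNilpotent_trace_of_isNilpotent (h g)).eq_zero
  have hpow {x} (hx : x ∈ N) (k : ℕ) : x ^ (k + 1) ∈ N := by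
    induction k with
    | zero => simpa
    | succ k ih => rw [pow_succ]; exact hmul ih hx
  let N' : LieSubalgebra ℤ (Module.End ℤ L) :=
    { N with lie_mem' := fun hx hy ↦ N.sub_mem (hmul hx hy) (hmul hy hx) }
  have : LieModule.IsNilpotent N' L :=
    LieModule.isNilpotent_iff_forall' (R := ℤ).2 fun x ↦
      LinearMap.isNilpotent_of_trace_pow_eq_zero x.1 fun k ↦ htr (hpow x.2 k)
  have := LieModule.nontrivial_max_triv_of_isNilpotent ℤ N' L
  obtain ⟨⟨v, hv⟩, hv0⟩ := exists_ne (0 : LieModule.maxTrivSubmodule ℤ N' L)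
  refine Submodule.ne_bot_iff _ |>.2 ⟨v, fun g ↦ ?_, fun h0 ↦ hv0 (Subtype.ext h0)⟩
  have hg : (ρ g - 1) v = 0 :=
    (LieModule.mem_maxTrivSubmodule ℤ N' L v).1 hv ⟨ρ g - 1, Submodule.subset_span ⟨g, rfl⟩⟩
  simpa [sub_eq_zero] using hg

/-- The quotient of a torsion-free module by the invariants of a group is torsion-free. -/
theorem isTorsionFree_quotient_invariants [Module.IsTorsionFree ℤ L]
    (ρ : Representation ℤ G L) : Module.IsTorsionFree ℤ (L ⧸ ρ.invariants) := by
  refine Module.IsTorsionFree.of_smul_eq_zero fun n x hx ↦ ?_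
  obtain ⟨x, rfl⟩ := Submodule.Quotient.mk_surjective _ x
  rw [← Submodule.Quotient.mk_smul, Submodule.Quotient.mk_eq_zero] at hx
  by_cases hn : n = 0
  · exact Or.inl hn
  · right
    rw [Submodule.Quotient.mk_eq_zero]
    intro g
    have := hx g
    rw [map_smul] at this
    exact smul_right_injective L hn this

/-- The representation on the quotient by the invariants. -/
noncomputable abbrev quotientInvariants (ρ : Representation ℤ G L) :
    Representation ℤ G (L ⧸ ρ.invariants) :=
  ρ.quotient ρ.invariants fun g v hv ↦ by
    rw [Submodule.mem_comap, hv g]; exact hv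

theorem sub_mem_invariants_of_mem_ker {ρ : Representation ℤ G L} {g : G}
    (hg : g ∈ ρ.quotientInvariants.ker) (v : L) : ρ g v - v ∈ ρ.invariants := by
  rw [← Submodule.Quotient.eq]
  exact LinearMap.congr_fun (MonoidHom.mem_ker.1 hg) (Submodule.Quotient.mk v)

/-- The homomorphism `g ↦ ρ g - 1` from the elements acting trivially modulo the invariants `F`
to the linear maps `L ⧸ F → F`. -/
noncomputable def kerQuotientInvariantsHom (ρ : Representation ℤ G L) :
    ρ.quotientInvariants.ker →* Multiplicative (L ⧸ ρ.invariants →ₗ[ℤ] ρ.invariants) :=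
  MonoidHom.mk' (fun g ↦ Multiplicative.ofAdd <| ρ.invariants.liftQ
    ((ρ g - 1).codRestrict ρ.invariants fun v ↦ sub_mem_invariants_of_mem_ker g.2 v)
    fun v hv ↦ Subtype.ext (sub_eq_zero.2 (hv g))) fun g k ↦ by
      refine Multiplicative.toAdd.injective (Submodule.linearMap_qext _ (LinearMap.ext fun v ↦
        Subtype.ext ?_))
      have := sub_mem_invariants_of_mem_ker k.2 v g
      rw [map_sub] at this
      change ρ (g * k) v - v = (ρ g v - v) + (ρ k v - v)
      rw [map_mul, Module.End.mul_apply, ← sub_add_cancel (ρ g (ρ k v)) (ρ g v), this]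
      abel

theorem apply_eq_one_of_kerQuotientInvariantsHom_eq_one {ρ : Representation ℤ G L}
    {g : ρ.quotientInvariants.ker} (hg : ρ.kerQuotientInvariantsHom g = 1) : ρ g = 1 := by
  ext v
  have := congrArg Subtype.val
    (LinearMap.congr_fun (congrArg Multiplicative.toAdd hg) (Submodule.Quotient.mk v))
  exact sub_eq_zero.1 this

end Representation

/-- A homomorphism to a lattice of rank `r` is generated by `r` elements modulo its kernel. -/
theorem MonoidHom.exists_finset_closure_sup_ker_eq_top {K A : Type*} [Group K] [AddCommGroup A]
    [Module.Free ℤ A] [Module.Finite ℤ A] (φ : K →* Multiplicative A) :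
    ∃ T : Finset K, T.card ≤ Module.finrank ℤ A ∧
      Subgroup.closure (T : Set K) ⊔ φ.ker = ⊤ := by
  classical
  let N : Submodule ℤ A := AddSubgroup.toIntSubmodule (Subgroup.toAddSubgroup' φ.range)
  let b := Module.finBasis ℤ N
  have hmem (i) : ∃ k, φ k = Multiplicative.ofAdd (b i : A) := (b i).2
  choose t ht using hmem
  refine ⟨Finset.univ.image t, ?_, ?_⟩
  · calc _ ≤ Module.finrank ℤ N := by simpa using Finset.card_image_le (s := Finset.univ) (f := t)
      _ ≤ _ := Submodule.finrank_le N
  · refine codisjoint_iff.1 (Subgroup.map_eq_range_iff.1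
      (le_antisymm (Subgroup.map_le_range _ _) ?_))
    rintro _ ⟨k, rfl⟩
    let x : N := ⟨Multiplicative.toAdd (φ k), k, rfl⟩
    have hx : φ k = ∏ i, (φ (t i)) ^ (b.repr x i) := by
      refine Multiplicative.toAdd.injective ?_
      have := congrArg Subtype.val (b.sum_repr x)
      rw [Submodule.coe_sum] at this
      simp only [ht, toAdd_prod, toAdd_zpow, toAdd_ofAdd]
      exact this.symm
    rw [hx]
    refine Subgroup.prod_mem _ fun i _ ↦ Subgroup.zpow_mem _ ?_ _
    exact Subgroup.mem_map_of_mem _ (Subgroup.subset_closure (by simp))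

/-- A group acting unipotently on a lattice of rank `n` is generated, modulo the kernel of the
action, by at most `n * (n - 1) / 2` elements. -/
theorem Representation.exists_finset_closure_sup_ker_eq_top {G : Type*} [Group G] {n : ℕ}
    {L : Type*} [AddCommGroup L] [Module.Free ℤ L] [Module.Finite ℤ L]
    (ρ : Representation ℤ G L) (h : ∀ g, IsNilpotent (ρ g - 1)) (hn : Module.finrank ℤ L = n) :
    ∃ S : Finset G, S.card ≤ n * (n - 1) / 2 ∧ Subgroup.closure (S : Set G) ⊔ ρ.ker = ⊤ := by
  classical
  induction n using Nat.strong_induction_on generalizing L with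
  | _ n ih =>
    rcases subsingleton_or_nontrivial L with hL | hL
    · refine ⟨∅, by simp, eq_top_iff.2 fun g _ ↦ Subgroup.mem_sup_right ?_⟩
      exact LinearMap.ext fun v ↦ Subsingleton.elim _ _
    have hF := ρ.invariants_ne_bot_of_isNilpotent_sub_one h
    have := ρ.isTorsionFree_quotient_invariants
    have hfree : Module.Free ℤ (L ⧸ ρ.invariants) := inferInstance
    have hadd := ρ.invariants.finrank_quotient_add_finrank
    have hpos : Module.finrank ℤ ρ.invariants ≠ 0 := fun h0 ↦
      hF (Submodule.finrank_eq_zero.1 h0)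
    have hq (g : G) : IsNilpotent (ρ.quotientInvariants g - 1) := by
      obtain ⟨k, hk⟩ := h g
      refine ⟨k, ?_⟩
      have hcomp (j : ℕ) (v : L) : ((ρ.quotientInvariants g - 1) ^ j) (Submodule.Quotient.mk v)
          = Submodule.Quotient.mk (((ρ g - 1) ^ j) v) := by
        induction j generalizing v with
        | zero => rfl
        | succ j ihj =>
          rw [pow_succ, pow_succ, Module.End.mul_apply, Module.End.mul_apply, ← ihj]
          rfl
      refine Submodule.linearMap_qext _ (LinearMap.ext fun v ↦ ?_)
      exact (hcomp k v).trans (by rw [hk]; rfl)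
    obtain ⟨S, hS, hSgen⟩ := ih _ (by omega) ρ.quotientInvariants hq rfl
    obtain ⟨T, hT, hTgen⟩ := ρ.kerQuotientInvariantsHom.exists_finset_closure_sup_ker_eq_top
    rw [Module.finrank_linearMap] at hT
    refine ⟨S ∪ T.image Subtype.val, ?_, ?_⟩
    · have h1 := Finset.card_union_le S (T.image Subtype.val)
      have h2 : (T.image Subtype.val).card ≤ T.card := Finset.card_image_le
      rw [← hn, ← hadd]
      refine (h1.trans (add_le_add hS (h2.trans hT))).trans ?_
      generalize Module.finrank ℤ (L ⧸ ρ.invariants) = m at *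
      obtain ⟨f, hf⟩ := Nat.exists_eq_succ_of_ne_zero hpos
      rw [hf, Nat.le_div_iff_mul_le two_pos, add_mul]
      refine (add_le_add_left (Nat.div_mul_le_self _ 2) _).trans ?_
      rcases m with _ | m
      · simp
      · simp only [Nat.succ_eq_add_one, Nat.add_sub_cancel, ← add_assoc]
        nlinarith [Nat.zero_le (f * f)]
    · rw [eq_top_iff, ← hSgen, sup_le_iff]
      refine ⟨le_sup_of_le_left (Subgroup.closure_mono (by simp)), ?_⟩
      have := congrArg (Subgroup.map ρ.quotientInvariants.ker.subtype) hTgen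
      rw [Subgroup.map_sup, MonoidHom.map_closure, ← MonoidHom.range_eq_map,
        Subgroup.range_subtype] at this
      refine this.ge.trans (sup_le_sup (Subgroup.closure_mono (by simp)) ?_)
      rintro _ ⟨g, hg, rfl⟩
      exact Representation.apply_eq_one_of_kerQuotientInvariantsHom_eq_one hg

/-- A group with a finitely generated subgroup of finite index is finitely generated. -/
theorem Subgroup.FG.of_finiteIndex_subgroupOf {Γ : Type*} [Group Γ] {U G : Subgroup Γ}
    (hU : U.FG) (hUG : U ≤ G) (hfi : (U.subgroupOf G).FiniteIndex) : G.FG := by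
  obtain ⟨S, hS⟩ := hU
  have : Finite (G ⧸ U.subgroupOf G) := Subgroup.finite_quotient_of_finiteIndex
  rw [Subgroup.fg_iff]
  refine ⟨S ∪ Set.range fun q : G ⧸ U.subgroupOf G ↦ (q.out : Γ), le_antisymm ?_ fun g hg ↦ ?_,
    S.finite_toSet.union (Set.finite_range _)⟩
  · rw [Subgroup.closure_le, Set.union_subset_iff, ← Subgroup.closure_le, hS]
    exact ⟨hUG, by rintro _ ⟨q, rfl⟩; exact q.out.2⟩
  · obtain ⟨u, hu⟩ := QuotientGroup.mk_out_eq_mul (U.subgroupOf G) ⟨g, hg⟩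
    have hu' : g = ((QuotientGroup.mk ⟨g, hg⟩ : G ⧸ U.subgroupOf G).out : Γ)
        * (u : Γ)⁻¹ := by
      rw [hu]; simp
    rw [hu']
    refine mul_mem (Subgroup.subset_closure (Or.inr ⟨_, rfl⟩)) (inv_mem ?_)
    refine Subgroup.closure_mono Set.subset_union_left ?_
    rw [hS]
    exact u.2

/-- If `G ≤ GL(L)` for a lattice `L ≅ ℤ^ℓ` has a finite-index normal subgroup
`U` consisting of unipotent elements, then `G | L` is finitely generated; more
precisely the unipotent part `U | L` is generated by at most `ℓ(ℓ−1)/2`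
elements. -/
theorem stmt18 (ℓ : ℕ) (G U : Subgroup (GL (Fin ℓ) ℤ))
    (hUG : U ≤ G) (hnorm : (U.subgroupOf G).Normal)
    (hfi : (U.subgroupOf G).FiniteIndex)
    (hunip : ∀ u ∈ U, IsNilpotent ((u : Matrix (Fin ℓ) (Fin ℓ) ℤ) - 1)) :
    (∃ S : Set (GL (Fin ℓ) ℤ), S.Finite ∧ S.ncard ≤ ℓ * (ℓ - 1) / 2 ∧
        Subgroup.closure S = U) ∧
      ∃ T : Set (GL (Fin ℓ) ℤ), T.Finite ∧ Subgroup.closure T = G := by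
  classical
  let Φ := (Matrix.toLinAlgEquiv' (R := ℤ) (n := Fin ℓ))
  let ρ : Representation ℤ U (Fin ℓ → ℤ) :=
    (Φ : _ →* _).comp ((Units.coeHom (Matrix (Fin ℓ) (Fin ℓ) ℤ)).comp U.subtype)
  have hρ : Function.Injective ρ :=
    Φ.injective.comp (Units.val_injective.comp Subtype.val_injective)
  obtain ⟨S, hcard, hS⟩ := ρ.exists_finset_closure_sup_ker_eq_top (n := ℓ)
    (fun u ↦ by
      have := (hunip u u.2).map Φ
      rwa [map_sub, map_one] at this) (by simp)
  rw [(MonoidHom.ker_eq_bot_iff ρ).2 hρ, sup_bot_eq] at hS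
  have hSU : Subgroup.closure ((S.image Subtype.val : Finset (GL (Fin ℓ) ℤ)) : Set _) = U := by
    have := congrArg (Subgroup.map U.subtype) hS
    rw [MonoidHom.map_closure, ← MonoidHom.range_eq_map, Subgroup.range_subtype] at this
    simpa using this
  refine ⟨⟨_, Finset.finite_toSet _, ?_, hSU⟩, ?_⟩
  · rw [Set.ncard_coe_finset]
    exact Finset.card_image_le.trans hcard
  · obtain ⟨T, hT⟩ := Subgroup.FG.of_finiteIndex_subgroupOf ⟨_, hSU⟩ hUG hfi
    exact ⟨T, T.finite_toSet, hT⟩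
end
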